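/- Let P, Q be real numbers with P > 0, Q < 0 and D := P² - 4Q > 0, let α := (P + √D)/2, and let U_n, V_n be the Lucas sequences with parameters (P,Q). Then for every odd positive integer k, ∑_{n=1}^{∞} L( -V_k² · Q^{k(2n-1)} / (D · U_{2kn}²) ) + ∑_{n=1}^{∞} L( V_k² · Q^{2kn} / V_{k(2n+1)}² ) = L( -Q^k / α^{2k} ). -/

import Mathlib

/-- The Rogers dilogarithm on `[0,1]`: `L(x) = Li₂(x) + (1/2)·log x · log (1-x)`
for `0 < x < 1`, with `L 0 = 0` and `L 1 = π²/6`. -/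
noncomputable def rogersL (x : ℝ) : ℝ :=
  if x = 0 then 0
  else if x = 1 then Real.pi ^ 2 / 6
  else (∑' n : ℕ, x ^ (n + 1) / ((n : ℝ) + 1) ^ 2) + 1 / 2 * Real.log x * Real.log (1 - x)

/-- Lucas sequence of the first kind: `U 0 = 0`, `U 1 = 1`, `U (n+2) = P·U (n+1) - Q·U n`. -/
noncomputable def lucasU (P Q : ℝ) : ℕ → ℝ
  | 0 => 0
  | 1 => 1
  | n + 2 => P * lucasU P Q (n + 1) - Q * lucasU P Q n

/-- Lucas sequence of the second kind: `V 0 = 2`, `V 1 = P`, `V (n+2) = P·V (n+1) - Q·V n`. -/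
noncomputable def lucasV (P Q : ℝ) : ℕ → ℝ
  | 0 => 2
  | 1 => P
  | n + 2 => P * lucasV P Q (n + 1) - Q * lucasV P Q n

section

open Filter Topology Set

/-- On `[0,1]` the closed formula for the Rogers dilogarithm is valid at the endpoints too. -/
lemma rogersL_eq (x : ℝ) :
    rogersL x = (∑' n : ℕ, x ^ (n + 1) / ((n : ℝ) + 1) ^ 2)
      + 1 / 2 * (Real.log x * Real.log (1 - x)) := by
  unfold rogersL
  split_ifs with h0 h1
  · simp [h0]
  · have h := (hasSum_nat_add_iff' 1).2 hasSum_zeta_two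
    subst h1
    have h2 := h.tsum_eq
    simp only [Finset.range_one, Finset.sum_singleton] at h2
    push_cast at h2
    simp only [one_pow, h2]
    simp
  · ring

lemma summable_one_div_succ_sq : Summable fun n : ℕ => 1 / ((n : ℝ) + 1) ^ 2 := by
  have h := (summable_nat_add_iff 1).2 (Real.summable_one_div_nat_pow.2 one_lt_two)
  simpa using h

lemma continuousOn_dilog :
    ContinuousOn (fun x : ℝ => ∑' n : ℕ, x ^ (n + 1) / ((n : ℝ) + 1) ^ 2) (Icc 0 1) := by
  refine continuousOn_tsum (fun n => by fun_prop) summable_one_div_succ_sq ?_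
  intro n x hx
  rw [Real.norm_of_nonneg (by have := hx.1; positivity)]
  gcongr
  exact pow_le_one₀ hx.1 hx.2

lemma continuousAt_log_mul_log_one_sub_zero :
    ContinuousAt (fun x : ℝ => Real.log x * Real.log (1 - x)) 0 := by
  set f : ℝ → ℝ := fun x => Real.log (1 - x) with hf
  have hd : DifferentiableAt ℝ f 0 := by
    refine DifferentiableAt.log (by fun_prop) (by norm_num)
  have h1 : ContinuousAt (dslope f 0) 0 := continuousAt_dslope_same.2 hd
  have h2 : ContinuousAt (fun x : ℝ => x * Real.log x) 0 :=
    Real.continuous_mul_log.continuousAt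
  have h3 := h2.mul h1
  refine h3.congr (Eventually.of_forall fun x => ?_)
  have h4 := sub_smul_dslope f 0 x
  simp only [hf, sub_zero, smul_eq_mul, Real.log_one] at h4
  simp only [Pi.mul_apply]
  rw [← h4]
  ring

lemma continuous_log_mul_log_one_sub :
    Continuous (fun x : ℝ => Real.log x * Real.log (1 - x)) := by
  rw [continuous_iff_continuousAt]
  intro x
  by_cases h0 : x = 0
  · subst h0
    exact continuousAt_log_mul_log_one_sub_zero
  by_cases h1 : x = 1
  · subst h1
    have h : ContinuousAt (fun x : ℝ => 1 - x) 1 := by fun_prop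
    have h' := ContinuousAt.comp_of_eq continuousAt_log_mul_log_one_sub_zero h (by norm_num)
    refine h'.congr (Eventually.of_forall fun x => ?_)
    simp [mul_comm]
  · have h2 : (1 : ℝ) - x ≠ 0 := fun h => h1 (by linarith)
    exact (Real.continuousAt_log h0).mul (ContinuousAt.log (by fun_prop) h2)

lemma continuousOn_rogersL : ContinuousOn rogersL (Icc 0 1) := by
  rw [funext rogersL_eq]
  exact continuousOn_dilog.add (continuous_log_mul_log_one_sub.const_smul (1 / 2 : ℝ)).continuousOn

lemma hasDerivAt_dilog {x : ℝ} (h0 : 0 < x) (h1 : x < 1) :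
    HasDerivAt (fun x : ℝ => ∑' n : ℕ, x ^ (n + 1) / ((n : ℝ) + 1) ^ 2)
      (-Real.log (1 - x) / x) x := by
  obtain ⟨r, hxr, hr1⟩ := exists_between h1
  have hr0 : 0 < r := h0.trans hxr
  have hd := hasDerivAt_tsum_of_isPreconnected (𝕜 := ℝ)
    (g := fun (n : ℕ) (x : ℝ) => x ^ (n + 1) / ((n : ℝ) + 1) ^ 2)
    (g' := fun (n : ℕ) (x : ℝ) => x ^ n / ((n : ℝ) + 1)) (u := fun n => r ^ n)
    (t := Ioo (-r) r) (y₀ := 0) (y := x)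
    (summable_geometric_of_lt_one hr0.le hr1) isOpen_Ioo isPreconnected_Ioo
    (fun n y _ => by
      have h := (hasDerivAt_pow (n + 1) y).div_const (((n : ℝ) + 1) ^ 2)
      refine h.congr_deriv ?_
      have : (n : ℝ) + 1 ≠ 0 := by positivity
      push_cast
      field_simp)
    (fun n y hy => by
      have hy' : |y| ≤ r := abs_le.2 ⟨hy.1.le, hy.2.le⟩
      rw [norm_div, norm_pow, Real.norm_eq_abs, Real.norm_of_nonneg (by positivity)]
      calc |y| ^ n / ((n : ℝ) + 1) ≤ |y| ^ n := div_le_self (by positivity) (by simp)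
        _ ≤ r ^ n := by gcongr)
    ⟨by linarith, hr0⟩ (by simp) ⟨by linarith, hxr⟩
  refine hd.congr_deriv ?_
  have hs := (Real.hasSum_pow_div_log_of_abs_lt_one (abs_lt.2 ⟨by linarith, h1⟩)).div_const x
  rw [← hs.tsum_eq]
  refine tsum_congr fun n => ?_
  have : (n : ℝ) + 1 ≠ 0 := by positivity
  field_simp
  ring

lemma hasDerivAt_rogersL {x : ℝ} (h0 : 0 < x) (h1 : x < 1) :
    HasDerivAt rogersL (-(1 / 2) * (Real.log (1 - x) / x + Real.log x / (1 - x))) x := by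
  rw [funext rogersL_eq]
  have h1' : 1 - x ≠ 0 := by linarith
  have hl := ((hasDerivAt_id x).const_sub 1).log h1'
  have h := (hasDerivAt_dilog h0 h1).add
    ((((Real.hasDerivAt_log h0.ne').mul hl)).const_mul (1 / 2 : ℝ))
  refine h.congr_deriv ?_
  simp only [id]
  field_simp
  ring

lemma rogersL_nonneg {x : ℝ} (h0 : 0 ≤ x) (h1 : x ≤ 1) : 0 ≤ rogersL x := by
  rw [rogersL_eq]
  have h2 := Real.log_nonpos h0 h1
  have h3 := Real.log_nonpos (sub_nonneg.2 h1) (by linarith)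
  have h4 := mul_nonneg_of_nonpos_of_nonpos h2 h3
  have h5 : 0 ≤ ∑' n : ℕ, x ^ (n + 1) / ((n : ℝ) + 1) ^ 2 := tsum_nonneg fun n => by positivity
  linarith

@[simp] lemma rogersL_zero : rogersL 0 = 0 := by simp [rogersL]

@[simp] lemma rogersL_one : rogersL 1 = Real.pi ^ 2 / 6 := by simp [rogersL]

lemma eq_left_of_hasDerivAt_zero {f : ℝ → ℝ} {a b : ℝ} (hab : a < b)
    (hf : ContinuousOn f (Icc a b)) (hf' : ∀ x ∈ Ioo a b, HasDerivAt f 0 x) : f b = f a := by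
  obtain ⟨c, -, hc⟩ := exists_hasDerivAt_eq_slope f (fun _ => 0) hab hf hf'
  have : b - a ≠ 0 := by linarith
  field_simp at hc
  linarith

/-- Euler's reflection formula. -/
lemma rogersL_add_rogersL_one_sub {x : ℝ} (h0 : 0 < x) (h1 : x < 1) :
    rogersL x + rogersL (1 - x) = Real.pi ^ 2 / 6 := by
  have h := eq_left_of_hasDerivAt_zero (f := fun x => rogersL x + rogersL (1 - x)) h0
    (by
      refine (continuousOn_rogersL.mono (Icc_subset_Icc_right h1.le)).add
        (continuousOn_rogersL.comp (by fun_prop) ?_)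
      intro t ht
      exact ⟨by linarith [ht.2], by linarith [ht.1]⟩)
    (fun t ht => by
      have ht1 : t < 1 := ht.2.trans h1
      have ha := hasDerivAt_rogersL ht.1 ht1
      have hb := hasDerivAt_rogersL (x := 1 - t) (by linarith) (by linarith [ht.1])
      have hc := ha.add (hb.comp t ((hasDerivAt_id t).const_sub 1))
      refine hc.congr_deriv ?_
      simp only [sub_sub_cancel]
      ring)
  simpa using h

/-- The five-term relation. -/
lemma rogersL_add_rogersL {x z : ℝ} (hx0 : 0 < x) (hx1 : x < 1) (hz0 : 0 < z) (hz1 : z < 1) :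
    rogersL x + rogersL z = rogersL (x * z) + rogersL (x * (1 - z) / (1 - x * z))
      + rogersL (z * (1 - x) / (1 - x * z)) := by
  have hpos : ∀ t, 0 ≤ t → t ≤ x → 0 < 1 - t * z := fun t h0 h1 => by nlinarith
  have hu : ∀ t, 0 ≤ t → t ≤ x → 1 - t * (1 - z) / (1 - t * z) = (1 - t) / (1 - t * z) :=
    fun t h0 h1 => by rw [one_sub_div (hpos t h0 h1).ne']; ring
  have hv : ∀ t, 0 ≤ t → t ≤ x → 1 - z * (1 - t) / (1 - t * z) = (1 - z) / (1 - t * z) :=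
    fun t h0 h1 => by rw [one_sub_div (hpos t h0 h1).ne']; ring
  have hcu : ContinuousOn (fun t => t * (1 - z) / (1 - t * z)) (Icc 0 x) :=
    ContinuousOn.div (by fun_prop) (by fun_prop) fun t ht => (hpos t ht.1 ht.2).ne'
  have hcv : ContinuousOn (fun t => z * (1 - t) / (1 - t * z)) (Icc 0 x) :=
    ContinuousOn.div (by fun_prop) (by fun_prop) fun t ht => (hpos t ht.1 ht.2).ne'
  have h := eq_left_of_hasDerivAt_zero
    (f := fun t => rogersL t - rogersL (t * z) - rogersL (t * (1 - z) / (1 - t * z))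
      - rogersL (z * (1 - t) / (1 - t * z))) hx0
    (by
      refine (((continuousOn_rogersL.mono (Icc_subset_Icc_right hx1.le)).sub
        (continuousOn_rogersL.comp (by fun_prop) ?_)).sub
        (continuousOn_rogersL.comp hcu ?_)).sub (continuousOn_rogersL.comp hcv ?_)
      · intro t ht
        have := hpos t ht.1 ht.2
        exact ⟨mul_nonneg ht.1 hz0.le, by linarith⟩
      · intro t ht
        have h1 := hpos t ht.1 ht.2
        refine ⟨div_nonneg (mul_nonneg ht.1 (by linarith)) h1.le, sub_nonneg.1 ?_⟩
        rw [hu t ht.1 ht.2]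
        exact div_nonneg (by linarith [ht.2]) h1.le
      · intro t ht
        have h1 := hpos t ht.1 ht.2
        refine ⟨div_nonneg (mul_nonneg hz0.le (by linarith [ht.2])) h1.le, sub_nonneg.1 ?_⟩
        rw [hv t ht.1 ht.2]
        exact div_nonneg (by linarith) h1.le)
    (fun t ht => by
      have hw := hpos t ht.1.le ht.2.le
      have ht0 := ht.1
      have ht1 : 0 < 1 - t := by linarith [ht.2]
      have hz1' : 0 < 1 - z := by linarith
      have hut := hu t ht.1.le ht.2.le
      have hvt := hv t ht.1.le ht.2.le
      have hu0 : 0 < t * (1 - z) / (1 - t * z) := by positivity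
      have hv0 : 0 < z * (1 - t) / (1 - t * z) := by positivity
      have hu1 : 0 < 1 - t * (1 - z) / (1 - t * z) := by rw [hut]; positivity
      have hv1 : 0 < 1 - z * (1 - t) / (1 - t * z) := by rw [hvt]; positivity
      have dw : HasDerivAt (fun t => t * z) z t := by
        simpa using (hasDerivAt_id t).mul_const z
      have du := ((hasDerivAt_id t).mul_const (1 - z)).div (dw.const_sub 1) hw.ne'
      have dv := (((hasDerivAt_id t).const_sub 1).const_mul z).div (dw.const_sub 1) hw.ne'
      have d1 := hasDerivAt_rogersL ht0 (by linarith)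
      have d2 := (hasDerivAt_rogersL (x := t * z) (by positivity) (by linarith)).comp t dw
      have d3 := (hasDerivAt_rogersL hu0 (by linarith)).comp t du
      have d4 := (hasDerivAt_rogersL hv0 (by linarith)).comp t dv
      have d := ((d1.sub d2).sub d3).sub d4
      refine d.congr_deriv ?_
      simp only [id]
      rw [hut, hvt, Real.log_div (by positivity) hw.ne', Real.log_div (by positivity) hw.ne',
        Real.log_div (by positivity) hw.ne', Real.log_div (by positivity) hw.ne',
        Real.log_mul ht0.ne' hz0.ne', Real.log_mul ht0.ne' hz1'.ne',
        Real.log_mul hz0.ne' ht1.ne']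
      generalize Real.log (1 - t * z) = F
      generalize Real.log (1 - t) = C
      generalize Real.log (1 - z) = E
      generalize Real.log t = A
      generalize Real.log z = B
      have e1 := hw.ne'
      have e2 := ht1.ne'
      have e3 := hz1'.ne'
      field_simp
      ring)
  simp at h
  linarith

/-- The telescoping step behind `hasSum_rogersL`. -/
lemma rogersL_telescope {y : ℝ} (h0 : 0 < y) (h1 : y < 1) (m : ℕ) :
    rogersL (y ^ (m + 1) * (1 - y) ^ 2 / (1 - y ^ (m + 2)) ^ 2) =
      (rogersL (y ^ (m + 1) * (1 - y) / (1 - y ^ (m + 2))) + rogersL ((1 - y) / (1 - y ^ (m + 2))))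
      - (rogersL (y ^ (m + 2) * (1 - y) / (1 - y ^ (m + 3)))
        + rogersL ((1 - y) / (1 - y ^ (m + 3)))) := by
  have hp : ∀ j : ℕ, 0 < 1 - y ^ (j + 1) := fun j =>
    sub_pos.2 (pow_lt_one₀ h0.le h1 (Nat.succ_ne_zero j))
  have hy : 0 < 1 - y := by linarith
  have p1 := hp m
  have p2 := hp (m + 1)
  have p3 := hp (m + 2)
  have q1 := pow_pos h0 (m + 1)
  have s2 : y ^ (m + 2) = y * y ^ (m + 1) := by ring
  have s3 : y ^ (m + 3) = y ^ 2 * y ^ (m + 1) := by ring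
  simp only [add_assoc, Nat.reduceAdd] at p1 p2 p3
  rw [s2] at p2
  rw [s3] at p3
  rw [s2, s3]
  generalize y ^ (m + 1) = w at *
  have hx0 : 0 < w * (1 - y) / (1 - y * w) := by positivity
  have hz0 : 0 < (1 - y) / (1 - y * w) := by positivity
  have hx1 : w * (1 - y) / (1 - y * w) < 1 := by
    rw [div_lt_one p2]; linarith
  have hz1 : (1 - y) / (1 - y * w) < 1 := by
    rw [div_lt_one p2]; nlinarith
  have key := rogersL_add_rogersL hx0 hx1 hz0 hz1
  have e0 : w * (1 - y) / (1 - y * w) * ((1 - y) / (1 - y * w))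
      = w * (1 - y) ^ 2 / (1 - y * w) ^ 2 := by field_simp
  have e : 1 - w * (1 - y) ^ 2 / (1 - y * w) ^ 2
      = (1 - w) * (1 - y ^ 2 * w) / (1 - y * w) ^ 2 := by
    rw [one_sub_div (pow_pos p2 2).ne']
    ring
  have ez : 1 - (1 - y) / (1 - y * w) = y * (1 - w) / (1 - y * w) := by
    rw [one_sub_div p2.ne']
    ring
  have ex : 1 - w * (1 - y) / (1 - y * w) = (1 - w) / (1 - y * w) := by
    rw [one_sub_div p2.ne']
    ring
  have n1 := p1.ne'
  have n2 := p2.ne'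
  have n3 := p3.ne'
  have e1 : w * (1 - y) / (1 - y * w) * (y * (1 - w) / (1 - y * w))
      / ((1 - w) * (1 - y ^ 2 * w) / (1 - y * w) ^ 2) = y * w * (1 - y) / (1 - y ^ 2 * w) := by
    generalize 1 - w = A, 1 - y * w = B, 1 - y ^ 2 * w = C at n1 n2 n3 ⊢
    field_simp
  have e2 : (1 - y) / (1 - y * w) * ((1 - w) / (1 - y * w))
      / ((1 - w) * (1 - y ^ 2 * w) / (1 - y * w) ^ 2) = (1 - y) / (1 - y ^ 2 * w) := by
    generalize 1 - w = A, 1 - y * w = B, 1 - y ^ 2 * w = C at n1 n2 n3 ⊢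
    field_simp
  rw [e0, e, ez, ex, e1, e2] at key
  linarith

lemma hasSum_rogersL {y : ℝ} (h0 : 0 < y) (h1 : y < 1) :
    HasSum (fun m : ℕ => rogersL (y ^ (m + 1) * (1 - y) ^ 2 / (1 - y ^ (m + 2)) ^ 2))
      (rogersL y) := by
  have hy : 0 < 1 - y := by linarith
  have hp : ∀ j : ℕ, 0 < 1 - y ^ (j + 1) := fun j =>
    sub_pos.2 (pow_lt_one₀ h0.le h1 (Nat.succ_ne_zero j))
  rw [hasSum_iff_tendsto_nat_of_nonneg]
  · set g : ℕ → ℝ := fun m => rogersL (y ^ (m + 1) * (1 - y) / (1 - y ^ (m + 2)))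
      + rogersL ((1 - y) / (1 - y ^ (m + 2))) with hg
    have hsum : ∀ n, ∑ i ∈ Finset.range n,
        rogersL (y ^ (i + 1) * (1 - y) ^ 2 / (1 - y ^ (i + 2)) ^ 2) = g 0 - g n := fun n => by
      rw [← Finset.sum_range_sub']
      exact Finset.sum_congr rfl fun i _ => rogersL_telescope h0 h1 i
    simp only [hsum]
    have hg0 : g 0 = Real.pi ^ 2 / 6 := by
      have hr := rogersL_add_rogersL_one_sub (x := y / (1 + y)) (by positivity)
        (by rw [div_lt_one (by positivity)]; linarith)
      rw [← hr]
      have n2 : 1 - y ^ 2 ≠ 0 := (hp 1).ne'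
      have a1 : y ^ (0 + 1) * (1 - y) / (1 - y ^ (0 + 2)) = y / (1 + y) := by
        rw [zero_add, zero_add, div_eq_div_iff n2 (by positivity)]; ring
      have a2 : (1 - y) / (1 - y ^ (0 + 2)) = 1 - y / (1 + y) := by
        rw [zero_add, one_sub_div (by positivity), div_eq_div_iff n2 (by positivity)]; ring
      rw [hg]
      simp only [a1, a2]
    have hL : rogersL y = Real.pi ^ 2 / 6 - (rogersL 0 + rogersL (1 - y)) := by
      rw [← rogersL_add_rogersL_one_sub h0 h1]; simp
    rw [hg0, hL]
    refine tendsto_const_nhds.sub ?_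
    have hpow : ∀ j : ℕ, Tendsto (fun m : ℕ => y ^ (m + j)) atTop (𝓝 0) := fun j =>
      (tendsto_add_atTop_iff_nat j).2 (tendsto_pow_atTop_nhds_zero_of_lt_one h0.le h1)
    have hden : Tendsto (fun m : ℕ => 1 - y ^ (m + 2)) atTop (𝓝 1) := by
      simpa using (hpow 2).const_sub 1
    have t1 : Tendsto (fun m : ℕ => y ^ (m + 1) * (1 - y) / (1 - y ^ (m + 2))) atTop (𝓝 0) := by
      simpa [Pi.div_def] using ((hpow 1).mul_const (1 - y)).div hden one_ne_zero
    have t2 : Tendsto (fun m : ℕ => (1 - y) / (1 - y ^ (m + 2))) atTop (𝓝 (1 - y)) := by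
      simpa [Pi.div_def] using (tendsto_const_nhds (x := 1 - y)).div hden one_ne_zero
    refine Tendsto.add ?_ ?_
    · refine (continuousOn_rogersL 0 (by simp)).tendsto.comp
        (tendsto_nhdsWithin_iff.2 ⟨t1, Eventually.of_forall fun m => ?_⟩)
      have p1 := hp m
      have p2 := hp (m + 1)
      refine ⟨by positivity, (div_le_one p2).2 ?_⟩
      have : y ^ (m + 2) = y * y ^ (m + 1) := by ring
      simp only [add_assoc, Nat.reduceAdd]
      nlinarith
    · refine ((hasDerivAt_rogersL hy (by linarith)).continuousAt.tendsto).comp t2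
  · intro m
    have p1 := hp m
    have p2 : 0 < 1 - y ^ (m + 2) := hp (m + 1)
    have p3 : 0 < 1 - y ^ (m + 3) := hp (m + 2)
    refine rogersL_nonneg (by positivity) ((div_le_one (by positivity)).2 ?_)
    have s2 : y ^ (m + 2) = y * y ^ (m + 1) := by ring
    have s3 : y ^ (m + 3) = y ^ 2 * y ^ (m + 1) := by ring
    rw [s2]
    rw [s3] at p3
    have := mul_pos p1 p3
    nlinarith

lemma lucasV_eq {P Q a b : ℝ} (hs : a + b = P) (hp : a * b = Q) :
    ∀ n, lucasV P Q n = a ^ n + b ^ n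
  | 0 => by norm_num [lucasV]
  | 1 => by simp [lucasV, hs]
  | n + 2 => by
    rw [lucasV, lucasV_eq hs hp (n + 1), lucasV_eq hs hp n, ← hs, ← hp]
    ring

lemma sub_mul_lucasU_eq {P Q a b : ℝ} (hs : a + b = P) (hp : a * b = Q) :
    ∀ n, (a - b) * lucasU P Q n = a ^ n - b ^ n
  | 0 => by simp [lucasU]
  | 1 => by simp [lucasU]
  | n + 2 => by
    have h1 := sub_mul_lucasU_eq hs hp (n + 1)
    have h0 := sub_mul_lucasU_eq hs hp n
    rw [lucasU]
    linear_combination P * h1 - Q * h0 - (a ^ (n + 1) - b ^ (n + 1)) * hs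
      + (a ^ n - b ^ n) * hp

end

theorem stmt_9 (P Q : ℝ) (hP : 0 < P) (hQ : Q < 0) (hD : 0 < P ^ 2 - 4 * Q)
    (k : ℕ) (hk : 0 < k) (hkodd : Odd k) :
    (∑' n : ℕ, rogersL (-(lucasV P Q k ^ 2 * Q ^ (k * (2 * (n + 1) - 1))) /
        ((P ^ 2 - 4 * Q) * lucasU P Q (2 * k * (n + 1)) ^ 2))) +
      (∑' n : ℕ, rogersL (lucasV P Q k ^ 2 * Q ^ (2 * k * (n + 1)) /
        lucasV P Q (k * (2 * (n + 1) + 1)) ^ 2)) =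
      rogersL (-(Q ^ k) / ((P + Real.sqrt (P ^ 2 - 4 * Q)) / 2) ^ (2 * k)) := by
  have hsq := Real.sq_sqrt hD.le
  have hs0 := Real.sqrt_pos.2 hD
  set s := Real.sqrt (P ^ 2 - 4 * Q)
  obtain ⟨a, ha⟩ : ∃ a, a = (P + s) / 2 := ⟨_, rfl⟩
  obtain ⟨b, hb⟩ : ∃ b, b = (P - s) / 2 := ⟨_, rfl⟩
  have hsum : a + b = P := by rw [ha, hb]; ring
  have hprod : a * b = Q := by rw [ha, hb]; linear_combination -(1 / 4) * hsq
  have hDab : P ^ 2 - 4 * Q = (a - b) ^ 2 := by rw [← hsum, ← hprod]; ring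
  have ha0 : 0 < a := by rw [ha]; positivity
  have hb0 : b < 0 := by
    by_contra! h
    nlinarith
  rw [← ha]
  have hA0 : 0 < a ^ k := pow_pos ha0 k
  obtain ⟨y, hy⟩ : ∃ y, y = (-b / a) ^ k := ⟨_, rfl⟩
  have hy0 : 0 < y := by rw [hy]; exact pow_pos (div_pos (by linarith) ha0) k
  have hy1 : y < 1 := by
    rw [hy]
    exact pow_lt_one₀ (div_pos (by linarith) ha0).le
      ((div_lt_one ha0).2 (by linarith)) hk.ne'
  have hB : b ^ k = -(y * a ^ k) := by
    rw [hy, div_pow, hkodd.neg_pow]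
    field_simp
  have hQk : Q ^ k = -(y * (a ^ k) ^ 2) := by
    rw [← hprod, mul_pow, hB]; ring
  have hV : lucasV P Q k = a ^ k * (1 - y) := by
    rw [lucasV_eq hsum hprod, hB]; ring
  have hV' (n : ℕ) : lucasV P Q (k * (2 * (n + 1) + 1))
      = (a ^ k) ^ (2 * n + 3) * (1 - y ^ (2 * n + 3)) := by
    have hodd : Odd (2 * n + 3) := ⟨n + 1, by ring⟩
    rw [lucasV_eq hsum hprod, pow_mul, pow_mul, hB, show 2 * (n + 1) + 1 = 2 * n + 3 by ring,
      hodd.neg_pow, mul_pow]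
    ring
  have hU (n : ℕ) : (P ^ 2 - 4 * Q) * lucasU P Q (2 * k * (n + 1)) ^ 2
      = ((a ^ k) ^ (2 * n + 2) * (1 - y ^ (2 * n + 2))) ^ 2 := by
    have heven : Even (2 * n + 2) := ⟨n + 1, by ring⟩
    rw [hDab, ← mul_pow, sub_mul_lucasU_eq hsum hprod,
      show 2 * k * (n + 1) = k * (2 * n + 2) by ring, pow_mul, pow_mul, hB,
      heven.neg_pow, mul_pow]
    ring
  have hp : ∀ j : ℕ, 1 - y ^ (j + 1) ≠ 0 := fun j =>
    (sub_pos.2 (pow_lt_one₀ hy0.le hy1 (Nat.succ_ne_zero j))).ne'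
  have harg1 (n : ℕ) : -(lucasV P Q k ^ 2 * Q ^ (k * (2 * (n + 1) - 1))) /
        ((P ^ 2 - 4 * Q) * lucasU P Q (2 * k * (n + 1)) ^ 2)
      = y ^ (2 * n + 1) * (1 - y) ^ 2 / (1 - y ^ (2 * n + 2)) ^ 2 := by
    have hodd : Odd (2 * n + 1) := ⟨n, rfl⟩
    rw [hU, hV, show 2 * (n + 1) - 1 = 2 * n + 1 by omega, pow_mul, hQk, hodd.neg_pow]
    have h1 : 1 - y ^ (2 * n + 2) ≠ 0 := hp (2 * n + 1)
    have h2 := hA0.ne'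
    generalize a ^ k = A at *
    rw [div_eq_div_iff (by positivity) (by positivity)]
    ring
  have harg2 (n : ℕ) : lucasV P Q k ^ 2 * Q ^ (2 * k * (n + 1)) /
        lucasV P Q (k * (2 * (n + 1) + 1)) ^ 2
      = y ^ (2 * n + 1 + 1) * (1 - y) ^ 2 / (1 - y ^ (2 * n + 1 + 2)) ^ 2 := by
    have heven : Even (2 * n + 2) := ⟨n + 1, by ring⟩
    rw [hV', hV, show 2 * k * (n + 1) = k * (2 * n + 2) by ring, pow_mul, hQk, heven.neg_pow]
    have h1 : 1 - y ^ (2 * n + 3) ≠ 0 := hp (2 * n + 2)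
    have h2 := hA0.ne'
    simp only [add_assoc, Nat.reduceAdd]
    generalize a ^ k = A at *
    rw [div_eq_div_iff (by positivity) (by positivity)]
    ring
  have hrhs : -(Q ^ k) / a ^ (2 * k) = y := by
    rw [hQk, mul_comm 2 k, pow_mul]
    field_simp
  have hS := hasSum_rogersL hy0 hy1
  simp only [harg1, harg2, hrhs]
  rw [← hS.tsum_eq]
  exact tsum_even_add_odd
    (f := fun m : ℕ => rogersL (y ^ (m + 1) * (1 - y) ^ 2 / (1 - y ^ (m + 2)) ^ 2))
    (hS.summable.comp_injective fun i j h => by simpa using h)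
    (hS.summable.comp_injective fun i j h => by simpa using h)
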